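/- Let (X,d,μ) and (X',d',μ') be metric measure spaces with X, X' compact, p ≥ 1, δ a metric coupling, and h a probabilistic coupling of μ and μ'. Let S_δ be the relation consisting of pairs (F,F') with F a μ-centered observable, F' a μ'-centered observable, such that there exist metric observables f on X and f' on X' with f ⊔ f' 1-Lipschitz on (K ⊔ K', δ), F = f − ∫f dμ, and F' = f' − ∫f' dμ'. Then for all (F,F'), (G,G') ∈ S_δ, |(∫_X |F−G|^p dμ)^{1/p} − (∫_{X'} |F'−G'|^p dμ')^{1/p}| ≤ 4 (∫_{X×X'} δ^p(x,y) dh(x,y))^{1/p}; i.e., the structural distortion of S_δ with respect to the L_p pseudometrics d_{p,μ} and d_{p,μ'} is at most 4 (∫ δ^p dh)^{1/p}. -/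

import Mathlib

open MeasureTheory Metric

/-- The support of a measure: points all of whose neighborhoods have positive measure. -/
def msupport {X : Type*} [TopologicalSpace X] [MeasurableSpace X] (μ : Measure X) : Set X :=
  {x : X | ∀ U ∈ nhds x, 0 < μ U}

/-- `δ` is a metric coupling of `(X,d,μ)` and `(X',d',μ')`. -/
def MetricCoupling {X X' : Type*} [MetricSpace X] [MetricSpace X']
    [MeasurableSpace X] [MeasurableSpace X']
    (μ : Measure X) (μ' : Measure X') (δ : X ⊕ X' → X ⊕ X' → ℝ) : Prop :=
  (∀ z, δ z z = 0) ∧ (∀ z w, δ z w = δ w z) ∧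
  (∀ z w u, δ z u ≤ δ z w + δ w u) ∧ (∀ z w, δ z w = 0 → z = w) ∧
  (∀ x ∈ msupport μ, ∀ y ∈ msupport μ, δ (Sum.inl x) (Sum.inl y) = dist x y) ∧
  (∀ x ∈ msupport μ', ∀ y ∈ msupport μ', δ (Sum.inr x) (Sum.inr y) = dist x y)

/-- The function `f ⊔ f'` on `K ⊔ K'` is 1-Lipschitz with respect to `δ`. -/
def SqcupLipschitz {X X' : Type*} (K : Set X) (K' : Set X')
    (δ : X ⊕ X' → X ⊕ X' → ℝ) (f : X → ℝ) (f' : X' → ℝ) : Prop :=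
  ∀ z ∈ Sum.inl '' K ∪ Sum.inr '' K', ∀ w ∈ Sum.inl '' K ∪ Sum.inr '' K',
    |Sum.elim f f' z - Sum.elim f f' w| ≤ δ z w

open scoped ENNReal

section LpNorm

variable {Ω E : Type*} [MeasurableSpace Ω] [NormedAddCommGroup E] {P : Measure Ω} {r : ℝ≥0∞}

theorem lpNorm_mono_ae_real {w : Ω → E} {b : Ω → ℝ} (hb : MemLp b r P)
    (hwb : ∀ᵐ ω ∂P, ‖w ω‖ ≤ b ω) : lpNorm w r P ≤ lpNorm b r P := by
  by_cases hw : AEStronglyMeasurable w P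
  · rw [← toReal_eLpNorm hw, ← toReal_eLpNorm hb.aestronglyMeasurable]
    exact ENNReal.toReal_mono hb.eLpNorm_ne_top (eLpNorm_mono_ae_real hwb)
  · simp [hw]

theorem integral_norm_le_lpNorm [IsProbabilityMeasure P] {w : Ω → E} (hr : 1 ≤ r)
    (hw : MemLp w r P) : ∫ ω, ‖w ω‖ ∂P ≤ lpNorm w r P := by
  rw [← lpNorm_one_eq_integral_norm hw.aestronglyMeasurable,
    ← toReal_eLpNorm hw.aestronglyMeasurable, ← toReal_eLpNorm hw.aestronglyMeasurable]
  exact ENNReal.toReal_mono hw.eLpNorm_ne_top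
    (eLpNorm_le_eLpNorm_of_exponent_le hr hw.aestronglyMeasurable)

theorem abs_lpNorm_sub_lpNorm_le {u v : Ω → E} (hr : 1 ≤ r) (hu : MemLp u r P)
    (hv : MemLp v r P) : |lpNorm u r P - lpNorm v r P| ≤ lpNorm (u - v) r P :=
  abs_sub_le_iff.2
    ⟨sub_le_iff_le_add'.2 (lpNorm_le_lpNorm_add_lpNorm_sub' hv hr),
      sub_le_iff_le_add'.2 (lpNorm_le_lpNorm_add_lpNorm_sub hu hr)⟩

variable [NormedSpace ℝ E]

theorem lpNorm_sub_integral_le [IsProbabilityMeasure P] {w : Ω → E} (hr : 1 ≤ r)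
    (hw : MemLp w r P) : lpNorm (fun ω => w ω - ∫ ω', w ω' ∂P) r P ≤ 2 * lpNorm w r P := by
  have hconst : lpNorm (fun _ : Ω => ∫ ω', w ω' ∂P) r P ≤ lpNorm w r P := by
    rw [lpNorm_const (one_pos.trans_le hr).ne' (IsProbabilityMeasure.ne_zero P)]
    simpa using (norm_integral_le_integral_norm w).trans (integral_norm_le_lpNorm hr hw)
  have hsub := lpNorm_sub_le (g := fun _ : Ω => ∫ ω', w ω' ∂P) hw hr
  calc _ ≤ lpNorm w r P + lpNorm (fun _ : Ω => ∫ ω', w ω' ∂P) r P := hsub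
    _ ≤ 2 * lpNorm w r P := by linarith

theorem abs_lpNorm_sub_integral_sub_le [IsProbabilityMeasure P] {u v : Ω → E} {b : Ω → ℝ}
    (hr : 1 ≤ r) (hu : MemLp u r P) (hv : MemLp v r P) (hb : MemLp b r P)
    (huv : ∀ᵐ ω ∂P, ‖u ω - v ω‖ ≤ b ω) :
    |lpNorm (fun ω => u ω - ∫ ω', u ω' ∂P) r P - lpNorm (fun ω => v ω - ∫ ω', v ω' ∂P) r P| ≤
      2 * lpNorm b r P := by
  have hcenter : (fun ω => u ω - ∫ ω', u ω' ∂P) - (fun ω => v ω - ∫ ω', v ω' ∂P) =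
      fun ω => (u - v) ω - ∫ ω', (u - v) ω' ∂P := by
    funext ω
    simp only [Pi.sub_apply]
    rw [integral_sub (hu.integrable hr) (hv.integrable hr)]
    abel
  calc _ ≤ lpNorm ((fun ω => u ω - ∫ ω', u ω' ∂P) - fun ω => v ω - ∫ ω', v ω' ∂P) r P :=
        abs_lpNorm_sub_lpNorm_le hr (hu.sub (memLp_const _)) (hv.sub (memLp_const _))
    _ ≤ 2 * lpNorm (u - v) r P := by
        rw [hcenter]
        exact lpNorm_sub_integral_le hr (hu.sub hv)
    _ ≤ 2 * lpNorm b r P := by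
        gcongr
        exact lpNorm_mono_ae_real hb huv

theorem lpNorm_ofReal_eq_integral_abs_rpow {w : Ω → ℝ} {p : ℝ} (hp : 0 < p)
    (hw : AEStronglyMeasurable w P) :
    lpNorm w (ENNReal.ofReal p) P = (∫ ω, |w ω| ^ p ∂P) ^ (1 / p) := by
  rw [lpNorm_eq_integral_norm_rpow_toReal (by simpa using hp) ENNReal.ofReal_ne_top hw]
  simp [ENNReal.toReal_ofReal hp.le]

end LpNorm

theorem integral_map_abs_sub_centered_rpow {Ω Y : Type*} [MeasurableSpace Ω]
    [TopologicalSpace Y] [CompactSpace Y] [MeasurableSpace Y] [BorelSpace Y]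
    {P : Measure Ω} [IsFiniteMeasure P] {p : ℝ} (hp : 0 ≤ p) {π : Ω → Y} (hπ : Measurable π)
    {k l : Y → ℝ} (hk : Continuous k) (hl : Continuous l) :
    ∫ y, |(k y - ∫ z, k z ∂P.map π) - (l y - ∫ z, l z ∂P.map π)| ^ p ∂P.map π =
      ∫ ω, |(k (π ω) - l (π ω)) - ∫ ω', (k (π ω') - l (π ω')) ∂P| ^ p ∂P := by
  have hint {m : Y → ℝ} (hm : Continuous m) : Integrable m (P.map π) :=
    hm.integrable_of_hasCompactSupport (.of_compactSpace m)
  have hmean : ∫ ω, (k (π ω) - l (π ω)) ∂P = (∫ z, k z ∂P.map π) - ∫ z, l z ∂P.map π := by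
    rw [← integral_sub (hint hk) (hint hl)]
    exact (integral_map hπ.aemeasurable (hint (hk.sub hl)).aestronglyMeasurable).symm
  have hcont : Continuous fun y =>
      |(k y - ∫ z, k z ∂P.map π) - (l y - ∫ z, l z ∂P.map π)| ^ p :=
    ((hk.sub continuous_const).sub (hl.sub continuous_const)).abs.rpow_const fun _ => .inr hp
  rw [integral_map hπ.aemeasurable (hint hcont).aestronglyMeasurable, hmean]
  simp only [sub_sub_sub_comm]

theorem msupport_eq_support {X : Type*} [TopologicalSpace X] [MeasurableSpace X]
    (μ : Measure X) : msupport μ = μ.support :=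
  Set.ext fun x => (Measure.mem_support_iff_forall x).symm

theorem ae_mem_msupport {X : Type*} [TopologicalSpace X] [HereditarilyLindelofSpace X]
    [MeasurableSpace X] (μ : Measure X) : ∀ᵐ x ∂μ, x ∈ msupport μ := by
  rw [msupport_eq_support]
  exact Measure.support_mem_ae

section Coupling

variable {X X' : Type*} [MetricSpace X] [MeasurableSpace X] [MetricSpace X'] [MeasurableSpace X']
  {μ : Measure X} {μ' : Measure X'} {δ : X ⊕ X' → X ⊕ X' → ℝ} {h : Measure (X × X')}

theorem MetricCoupling.nonneg (hδ : MetricCoupling μ μ' δ) (z w : X ⊕ X') : 0 ≤ δ z w := by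
  obtain ⟨hself, hsymm, htri, -⟩ := hδ
  linarith [hself z, hsymm z w, htri z w z]

theorem MetricCoupling.continuousOn (hδ : MetricCoupling μ μ' δ) :
    ContinuousOn (fun q : X × X' => δ (Sum.inl q.1) (Sum.inr q.2))
      (msupport μ ×ˢ msupport μ') := by
  obtain ⟨-, hsymm, htri, -, hdist, hdist'⟩ := hδ
  have hle : ∀ a ∈ msupport μ ×ˢ msupport μ', ∀ b ∈ msupport μ ×ˢ msupport μ',
      δ (Sum.inl a.1) (Sum.inr a.2) ≤ δ (Sum.inl b.1) (Sum.inr b.2) + 2 * dist a b := by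
    rintro a ⟨ha, ha'⟩ b ⟨hb, hb'⟩
    have hfst : dist a.1 b.1 ≤ dist a b := le_max_left _ _
    have hsnd : dist b.2 a.2 ≤ dist a b := dist_comm b.2 a.2 ▸ le_max_right _ _
    linarith [htri (Sum.inl a.1) (Sum.inl b.1) (Sum.inr a.2), hdist _ ha _ hb,
      htri (Sum.inl b.1) (Sum.inr b.2) (Sum.inr a.2), hdist' _ hb' _ ha']
  exact (LipschitzOnWith.of_le_add_mul 2 hle).continuousOn

theorem ae_mem_msupport_prod [SecondCountableTopology X] [SecondCountableTopology X']
    (h1 : h.map Prod.fst = μ) (h2 : h.map Prod.snd = μ') :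
    ∀ᵐ q ∂h, q ∈ msupport μ ×ˢ msupport μ' := by
  have hfst : ∀ᵐ q ∂h, q.1 ∈ msupport μ :=
    ae_of_ae_map measurable_fst.aemeasurable (h1.symm ▸ ae_mem_msupport μ)
  have hsnd : ∀ᵐ q ∂h, q.2 ∈ msupport μ' :=
    ae_of_ae_map measurable_snd.aemeasurable (h2.symm ▸ ae_mem_msupport μ')
  filter_upwards [hfst, hsnd] with q hq hq' using ⟨hq, hq'⟩

theorem MetricCoupling.memLp [CompactSpace X] [BorelSpace X] [CompactSpace X'] [BorelSpace X']
    [IsFiniteMeasure h] (hδ : MetricCoupling μ μ' δ)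
    (h1 : h.map Prod.fst = μ) (h2 : h.map Prod.snd = μ') (r : ℝ≥0∞) :
    MemLp (fun q : X × X' => δ (Sum.inl q.1) (Sum.inr q.2)) r h := by
  have hclosed : IsClosed (msupport μ ×ˢ msupport μ') := by
    rw [msupport_eq_support, msupport_eq_support]
    exact Measure.isClosed_support.prod Measure.isClosed_support
  have hmem := ae_mem_msupport_prod h1 h2
  have hmeas := hδ.continuousOn.aestronglyMeasurable (μ := h) hclosed.measurableSet
  rw [Measure.restrict_eq_self_of_ae_mem hmem] at hmeas
  obtain ⟨C, hC⟩ := hclosed.isCompact.exists_bound_of_continuousOn hδ.continuousOn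
  exact MemLp.of_bound hmeas C (hmem.mono hC)

theorem SqcupLipschitz.abs_sub_le {X X' : Type*} {K : Set X} {K' : Set X'}
    {δ : X ⊕ X' → X ⊕ X' → ℝ} {f : X → ℝ} {f' : X' → ℝ} (hf : SqcupLipschitz K K' δ f f')
    {x : X} {x' : X'} (hx : x ∈ K) (hx' : x' ∈ K') :
    |f x - f' x'| ≤ δ (Sum.inl x) (Sum.inr x') :=
  hf _ (Or.inl ⟨x, hx, rfl⟩) _ (Or.inr ⟨x', hx', rfl⟩)

end Coupling

/-- Structural distortion bound for the centered relation `S_δ`. If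
`(F,F')` and `(G,G')` belong to `S_δ` (i.e. each is obtained by μ- resp. μ'-centering
a pair of observables whose join is 1-Lipschitz for the metric coupling `δ`), then
`|‖F-G‖_{p,μ} - ‖F'-G'‖_{p,μ'}| ≤ 4 (∫ δ^p dh)^{1/p}` for any probabilistic
coupling `h`. -/
theorem centered_lp_distortion_bound {X X' : Type*}
    [MetricSpace X] [CompactSpace X] [MeasurableSpace X] [BorelSpace X]
    [MetricSpace X'] [CompactSpace X'] [MeasurableSpace X'] [BorelSpace X']
    (μ : Measure X) [IsProbabilityMeasure μ] (μ' : Measure X') [IsProbabilityMeasure μ']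
    (p : ℝ) (hp : 1 ≤ p)
    (δ : X ⊕ X' → X ⊕ X' → ℝ) (hδ : MetricCoupling μ μ' δ)
    (h : Measure (X × X')) [IsProbabilityMeasure h]
    (h1 : h.map Prod.fst = μ) (h2 : h.map Prod.snd = μ')
    (F G : X → ℝ) (F' G' : X' → ℝ)
    (hFF' : ∃ (f : X → ℝ) (f' : X' → ℝ), LipschitzWith 1 f ∧ LipschitzWith 1 f' ∧
      SqcupLipschitz (msupport μ) (msupport μ') δ f f' ∧
      F = (fun x => f x - ∫ y, f y ∂μ) ∧ F' = (fun x => f' x - ∫ y, f' y ∂μ'))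
    (hGG' : ∃ (g : X → ℝ) (g' : X' → ℝ), LipschitzWith 1 g ∧ LipschitzWith 1 g' ∧
      SqcupLipschitz (msupport μ) (msupport μ') δ g g' ∧
      G = (fun x => g x - ∫ y, g y ∂μ) ∧ G' = (fun x => g' x - ∫ y, g' y ∂μ')) :
    |(∫ x, |F x - G x| ^ p ∂μ) ^ (1 / p) - (∫ x, |F' x - G' x| ^ p ∂μ') ^ (1 / p)| ≤
      4 * (∫ q : X × X', δ (Sum.inl q.1) (Sum.inr q.2) ^ p ∂h) ^ (1 / p) := by
  subst h1 h2
  obtain ⟨f, f', hf, hf', hff', rfl, rfl⟩ := hFF'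
  obtain ⟨g, g', hg, hg', hgg', rfl, rfl⟩ := hGG'
  have hp0 : 0 < p := one_pos.trans_le hp
  have hr : 1 ≤ ENNReal.ofReal p := by simpa using hp
  have hu : Continuous fun x => f x - g x := hf.continuous.sub hg.continuous
  have hv : Continuous fun x => f' x - g' x := hf'.continuous.sub hg'.continuous
  have hD := hδ.memLp rfl rfl (ENNReal.ofReal p)
  have hbound : ∀ᵐ q ∂h, ‖(f q.1 - g q.1) - (f' q.2 - g' q.2)‖ ≤
      (2 : ℝ) • δ (Sum.inl q.1) (Sum.inr q.2) := by
    filter_upwards [ae_mem_msupport_prod (h := h) rfl rfl] with q hq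
    have hfq := abs_le.1 (hff'.abs_sub_le hq.1 hq.2)
    have hgq := abs_le.1 (hgg'.abs_sub_le hq.1 hq.2)
    rw [Real.norm_eq_abs, abs_le, smul_eq_mul]
    constructor <;> linarith
  have huL : MemLp (fun q : X × X' => f q.1 - g q.1) (ENNReal.ofReal p) h :=
    (hu.comp continuous_fst).memLp_of_hasCompactSupport (.of_compactSpace _)
  have hvL : MemLp (fun q : X × X' => f' q.2 - g' q.2) (ENNReal.ofReal p) h :=
    (hv.comp continuous_snd).memLp_of_hasCompactSupport (.of_compactSpace _)
  have hcu : AEStronglyMeasurable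
      (fun q : X × X' => (f q.1 - g q.1) - ∫ q', (f q'.1 - g q'.1) ∂h) h :=
    (huL.sub (memLp_const _)).aestronglyMeasurable
  have hcv : AEStronglyMeasurable
      (fun q : X × X' => (f' q.2 - g' q.2) - ∫ q', (f' q'.2 - g' q'.2) ∂h) h :=
    (hvL.sub (memLp_const _)).aestronglyMeasurable
  have key := abs_lpNorm_sub_integral_sub_le hr huL hvL (hD.const_smul (2 : ℝ)) hbound
  rw [lpNorm_const_smul, lpNorm_ofReal_eq_integral_abs_rpow hp0 hcu,
    lpNorm_ofReal_eq_integral_abs_rpow hp0 hcv,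
    lpNorm_ofReal_eq_integral_abs_rpow hp0 hD.aestronglyMeasurable] at key
  rw [integral_map_abs_sub_centered_rpow hp0.le measurable_fst hf.continuous hg.continuous,
    integral_map_abs_sub_centered_rpow hp0.le measurable_snd hf'.continuous hg'.continuous]
  refine key.trans_eq ?_
  simp only [abs_of_nonneg (hδ.nonneg _ _)]
  norm_num
  ring
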